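/- Assume strong duality q* = f* holds, and assume ‖g(u)‖₂ ≤ L for all u ∈ Ω. Let μ⁰ ∈ ℝ^m_+, α > 0, ε ≥ 0, and generate iterates for l = 0, …, k−1 by choosing u^l ∈ Ω with L(u^l, μ^l) ≤ min_{u ∈ Ω} L(u, μ^l) + ε and setting μ^{l+1} = P_+(μ^l + α g(u^l)). Then for every k ≥ 1 the primal average û^k = (1/k) Σ_{l=0}^{k−1} u^l satisfies f(û^k) ≤ f* + ‖μ⁰‖₂²/(2kα) + αL²/2 + ε. -/

import Mathlib

/-- Every value of the dual function at a nonnegative multiplier bounds the primal objective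
at feasible points from below. -/
theorem sInf_lagrangian_le {E ι : Type*} [Fintype ι] {Ω : Set E} {f : E → ℝ}
    {g : E → EuclideanSpace ℝ ι} {B : ℝ} (hf : BddBelow (f '' Ω))
    (hg : ∀ u ∈ Ω, ‖g u‖ ≤ B) {μ : EuclideanSpace ℝ ι} (hμ : ∀ j, 0 ≤ μ j)
    {v : E} (hv : v ∈ Ω) (hgv : ∀ j, g v j ≤ 0) :
    sInf ((fun u => f u + ∑ j, μ j * g u j) '' Ω) ≤ f v := by
  obtain ⟨b, hb⟩ := hf
  have hbdd : BddBelow ((fun u => f u + ∑ j, μ j * g u j) '' Ω) := by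
    refine ⟨b + ∑ j, μ j * (-B), ?_⟩
    rintro _ ⟨w, hw, rfl⟩
    refine add_le_add (hb ⟨w, hw, rfl⟩) (Finset.sum_le_sum fun j _ => ?_)
    have h := (PiLp.norm_apply_le (g w) j).trans (hg w hw)
    exact mul_le_mul_of_nonneg_left (abs_le.1 h).1 (hμ j)
  refine (csInf_le hbdd ⟨v, hv, rfl⟩).trans ?_
  have h : ∑ j, μ j * g v j ≤ 0 :=
    Finset.sum_nonpos fun j _ => mul_nonpos_of_nonneg_of_nonpos (hμ j) (hgv j)
  simpa using h

/-- Projecting a step onto the nonnegative orthant does not increase the norm. -/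
theorem norm_sq_projected_step_le {ι : Type*} [Fintype ι] {x y d : EuclideanSpace ℝ ι} {α : ℝ}
    (h : ∀ j, y j = max (x j + α * d j) 0) :
    ‖y‖ ^ 2 ≤ ‖x‖ ^ 2 + 2 * α * ∑ j, x j * d j + α ^ 2 * ‖d‖ ^ 2 := by
  simp only [EuclideanSpace.real_norm_sq_eq, Finset.mul_sum, ← Finset.sum_add_distrib]
  refine Finset.sum_le_sum fun j _ => ?_
  rw [h j]
  rcases max_cases (x j + α * d j) 0 with ⟨e, _⟩ | ⟨e, _⟩ <;> rw [e] <;>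
    nlinarith [sq_nonneg (x j + α * d j)]


/-- Under strong duality `q* = f*` and the norm bound `‖g(u)‖₂ ≤ L` on `Ω`,
the approximate dual subgradient method with step size `α`, suboptimality `ε` and
updates `μ^{l+1} = P₊(μ^l + α g(u^l))` produces a primal average
`û^k = (1/k) Σ_{l<k} u^l` with `f(û^k) ≤ f* + ‖μ⁰‖²/(2kα) + αL²/2 + ε` for all `k ≥ 1`. -/
theorem stmt_3 {n m : ℕ}
    (Ω : Set (EuclideanSpace ℝ (Fin n)))
    (hne : Ω.Nonempty) (hcomp : IsCompact Ω) (hconv : Convex ℝ Ω)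
    (f : EuclideanSpace ℝ (Fin n) → ℝ) (hf : ConvexOn ℝ Set.univ f)
    (g : EuclideanSpace ℝ (Fin n) → EuclideanSpace ℝ (Fin m))
    (hg : ∀ j, ConvexOn ℝ Set.univ (fun u => g u j))
    (L : EuclideanSpace ℝ (Fin n) → EuclideanSpace ℝ (Fin m) → ℝ)
    (hL : ∀ u μ, L u μ = f u + ∑ j, μ j * g u j)
    (q : EuclideanSpace ℝ (Fin m) → ℝ)
    (hq : ∀ μ, q μ = sInf ((fun u => L u μ) '' Ω))
    (qstar : ℝ) (hqstar : qstar = sSup (q '' {μ : EuclideanSpace ℝ (Fin m) | ∀ j, 0 ≤ μ j}))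
    (fstar : ℝ)
    (hfstar : IsLeast (f '' {u ∈ Ω | ∀ j, g u j ≤ 0}) fstar)
    (hstrong : qstar = fstar)
    (Lb : ℝ) (hLb : ∀ u ∈ Ω, ‖g u‖ ≤ Lb)
    (α : ℝ) (hα : 0 < α) (ε : ℝ) (hε : 0 ≤ ε)
    (k : ℕ) (hk : 1 ≤ k)
    (u : ℕ → EuclideanSpace ℝ (Fin n)) (μ : ℕ → EuclideanSpace ℝ (Fin m))
    (hμ0 : ∀ j, 0 ≤ μ 0 j)
    (hu : ∀ l < k, u l ∈ Ω)
    (happrox : ∀ l < k, L (u l) (μ l) ≤ q (μ l) + ε)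
    (hupd : ∀ l < k, ∀ j, μ (l + 1) j = max (μ l j + α * g (u l) j) 0) :
    f ((k : ℝ)⁻¹ • ∑ l ∈ Finset.range k, u l) ≤
      fstar + ‖μ 0‖ ^ 2 / (2 * k * α) + α * Lb ^ 2 / 2 + ε := by
  obtain ⟨⟨v, ⟨hv, hgv⟩, hfv⟩, -⟩ := hfstar
  have hfcont : Continuous f := hf.locallyLipschitz.continuous
  have hbdd : BddBelow (f '' Ω) := (hcomp.image hfcont).bddBelow
  have hμ : ∀ l ≤ k, ∀ j, 0 ≤ μ l j := by
    rintro (_ | l) hl j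
    · exact hμ0 j
    · rw [hupd l hl j]
      exact le_max_right _ _
  have hstep : ∀ l < k, f (u l) + ‖μ (l + 1)‖ ^ 2 / (2 * α) ≤
      ‖μ l‖ ^ 2 / (2 * α) + (fstar + α * Lb ^ 2 / 2 + ε) := by
    intro l hl
    have hq' : q (μ l) ≤ fstar := by
      simp only [hq, hL]
      exact (sInf_lagrangian_le hbdd hLb (hμ l hl.le) hv hgv).trans_eq hfv
    have ha := happrox l hl
    rw [hL] at ha
    have hn := norm_sq_projected_step_le (hupd l hl)
    have hg2 : α ^ 2 * ‖g (u l)‖ ^ 2 ≤ α ^ 2 * Lb ^ 2 := by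
      gcongr
      exact hLb _ (hu l hl)
    have hd : ‖μ (l + 1)‖ ^ 2 / (2 * α) ≤
        ‖μ l‖ ^ 2 / (2 * α) + ∑ j, μ l j * g (u l) j + α * Lb ^ 2 / 2 := by
      rw [div_le_iff₀ (by positivity)]
      field_simp
      linarith
    linarith
  have hsum : ∀ i ≤ k, ∑ l ∈ Finset.range i, f (u l) + ‖μ i‖ ^ 2 / (2 * α) ≤
      ‖μ 0‖ ^ 2 / (2 * α) + i * (fstar + α * Lb ^ 2 / 2 + ε) := by
    intro i
    induction i with
    | zero => simp
    | succ i ih =>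
      intro hi
      rw [Finset.sum_range_succ]
      push_cast
      linarith [ih (Nat.le_of_succ_le hi), hstep i hi]
  have hk0 : (0 : ℝ) < k := by exact_mod_cast hk
  have hjensen := hf.map_sum_le (t := Finset.range k) (w := fun _ => (k : ℝ)⁻¹) (p := u)
    (fun _ _ => by positivity) (by simp [hk0.ne']) (fun _ _ => Set.mem_univ _)
  rw [← Finset.smul_sum, ← Finset.smul_sum, smul_eq_mul] at hjensen
  have hpos : 0 ≤ ‖μ k‖ ^ 2 / (2 * α) := by positivity
  calc f ((k : ℝ)⁻¹ • ∑ l ∈ Finset.range k, u l)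
      ≤ (k : ℝ)⁻¹ * ∑ l ∈ Finset.range k, f (u l) := hjensen
    _ ≤ (k : ℝ)⁻¹ * (‖μ 0‖ ^ 2 / (2 * α) + k * (fstar + α * Lb ^ 2 / 2 + ε)) := by
        gcongr
        linarith [hsum k le_rfl]
    _ = fstar + ‖μ 0‖ ^ 2 / (2 * k * α) + α * Lb ^ 2 / 2 + ε := by
        field_simp
        ring
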